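/- arXiv:1206.2512 — 2 statements merged into one kernel-verified Lean document; each statement's English description precedes it below -/
import Mathlib

section
/- Fix a field k. For all integers r, c ≥ 2, every binomial generating set of the toric ideal I(3,r,c) of the no-3-way-interaction model on 3×r×c contingency tables contains a binomial of total degree 2·min(r,c). In particular, the maximum degree of generators needed for I(3,r,c) (the Markov complexity of the no-3-way-interaction model on 3×r×c tables) grows arbitrarily large as r and c increase. -/
open MvPolynomial

namespace No3Way

variable (K : Type) [Field K]

/-- The monomial map `t_{ijk} ↦ u_{ij} v_{ik} w_{jk}` of the no-`3`-way-interaction model on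
`a × r × c` contingency tables. -/
noncomputable def phi3 (a r c : ℕ) :
    MvPolynomial (Fin a × Fin r × Fin c) K →ₐ[K]
      MvPolynomial ((Fin a × Fin r) ⊕ (Fin a × Fin c) ⊕ (Fin r × Fin c)) K :=
  aeval (fun p : Fin a × Fin r × Fin c =>
    X (Sum.inl (p.1, p.2.1)) * X (Sum.inr (Sum.inl (p.1, p.2.2))) *
      X (Sum.inr (Sum.inr (p.2.1, p.2.2))))

/-- The toric ideal `I(a,r,c)` of the no-`3`-way-interaction model on `a × r × c` tables. -/
noncomputable def I3 (a r c : ℕ) : Ideal (MvPolynomial (Fin a × Fin r × Fin c) K) :=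
  RingHom.ker (phi3 K a r c).toRingHom

/-- A binomial: the difference of two distinct monic monomials. -/
def IsBinomial {σ : Type} (f : MvPolynomial σ K) : Prop :=
  ∃ a b : σ →₀ ℕ, a ≠ b ∧ f = monomial a 1 - monomial b 1

end No3Way

namespace No3Way

/-- exponent vector of the image of a variable -/
noncomputable def vv (r c : ℕ) (p : Fin 3 × Fin r × Fin c) :
    ((Fin 3 × Fin r) ⊕ (Fin 3 × Fin c) ⊕ (Fin r × Fin c)) →₀ ℕ :=
  Finsupp.single (Sum.inl (p.1, p.2.1)) 1 + Finsupp.single (Sum.inr (Sum.inl (p.1, p.2.2))) 1 +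
    Finsupp.single (Sum.inr (Sum.inr (p.2.1, p.2.2))) 1

/-- exponent vector of the image of a monomial -/
noncomputable def FF (r c : ℕ) (s : Fin 3 × Fin r × Fin c →₀ ℕ) :
    ((Fin 3 × Fin r) ⊕ (Fin 3 × Fin c) ⊕ (Fin r × Fin c)) →₀ ℕ :=
  ∑ p, s p • vv r c p

theorem phi3_monomial (K : Type) [Field K] (r c : ℕ) (s : Fin 3 × Fin r × Fin c →₀ ℕ) :
    phi3 K 3 r c (monomial s 1) = monomial (FF r c s) 1 := by
  unfold phi3 FF
  rw [aeval_monomial, Finsupp.prod_fintype _ _ (by simp), monomial_sum_one, map_one, one_mul]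
  refine Finset.prod_congr rfl fun p _ => ?_
  rw [← one_pow (M := K) (s p), ← monomial_pow]
  congr 1
  simp [vv, X, monomial_mul]

theorem FF_inl (r c : ℕ) (s : Fin 3 × Fin r × Fin c →₀ ℕ) (i : Fin 3) (j : Fin r) :
    FF r c s (Sum.inl (i, j)) = ∑ k, s (i, j, k) := by
  simp only [FF, Finsupp.finsetSum_apply, Fintype.sum_prod_type]
  rw [Finset.sum_eq_single i, Finset.sum_eq_single j]
  · simp [vv]
  · intro b _ hb
    simp [vv, hb]
  · simp
  · intro b _ hb
    simp [vv, hb]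
  · simp

theorem FF_inm (r c : ℕ) (s : Fin 3 × Fin r × Fin c →₀ ℕ) (i : Fin 3) (k : Fin c) :
    FF r c s (Sum.inr (Sum.inl (i, k))) = ∑ j, s (i, j, k) := by
  simp only [FF, Finsupp.finsetSum_apply, Fintype.sum_prod_type]
  rw [Finset.sum_eq_single i]
  · refine Finset.sum_congr rfl fun j _ => ?_
    rw [Finset.sum_eq_single k]
    · simp [vv]
    · intro b _ hb
      simp [vv, hb]
    · simp
  · intro b _ hb
    simp [vv, hb]
  · simp

theorem FF_inr (r c : ℕ) (s : Fin 3 × Fin r × Fin c →₀ ℕ) (j : Fin r) (k : Fin c) :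
    FF r c s (Sum.inr (Sum.inr (j, k))) = ∑ i, s (i, j, k) := by
  simp only [FF, Finsupp.finsetSum_apply, Fintype.sum_prod_type]
  refine Finset.sum_congr rfl fun i _ => ?_
  rw [Finset.sum_eq_single j, Finset.sum_eq_single k]
  · simp [vv]
  · intro b _ hb
    simp [vv, hb]
  · simp
  · intro b _ hb
    simp [vv, hb]
  · simp

theorem FF_add (r c : ℕ) (s t : Fin 3 × Fin r × Fin c →₀ ℕ) :
    FF r c (s + t) = FF r c s + FF r c t := by
  simp [FF, add_smul, Finset.sum_add_distrib]

theorem mem_I3_iff (K : Type) [Field K] (r c : ℕ) (s t : Fin 3 × Fin r × Fin c →₀ ℕ) :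
    (monomial s 1 - monomial t 1 : MvPolynomial _ K) ∈ I3 K 3 r c ↔ FF r c s = FF r c t := by
  unfold I3
  rw [RingHom.mem_ker]
  change phi3 K 3 r c _ = 0 ↔ _
  rw [map_sub, sub_eq_zero, phi3_monomial, phi3_monomial]
  exact (monomial_left_injective (R := K) one_ne_zero).eq_iff

/-- diagonal entries -/
def DD (m j k : ℕ) : ℕ := if j < m ∧ k = j then 1 else 0

/-- shifted diagonal entries -/
def EE (m j k : ℕ) : ℕ := if j < m ∧ k = (if j + 1 < m then j + 1 else 0) then 1 else 0

theorem DD_row {m c j : ℕ} (h : m ≤ c) :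
    ∑ k : Fin c, DD m j k = if j < m then 1 else 0 := by
  rw [Fin.sum_univ_eq_sum_range (fun k => DD m j k)]
  by_cases hj : j < m
  · have : j < c := by omega
    simp [DD, hj, this]
  · simp [DD, hj]

theorem EE_row {m c j : ℕ} (h : m ≤ c) :
    ∑ k : Fin c, EE m j k = if j < m then 1 else 0 := by
  rw [Fin.sum_univ_eq_sum_range (fun k => EE m j k)]
  by_cases hj : j < m
  · have : (if j + 1 < m then j + 1 else 0) < c := by split_ifs <;> omega
    simp [EE, hj, this]
  · simp [EE, hj]

theorem DD_col {m r k : ℕ} (h : m ≤ r) :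
    ∑ j : Fin r, DD m j k = if k < m then 1 else 0 := by
  rw [Fin.sum_univ_eq_sum_range (fun j => DD m j k), ← DD_row (j := k) h,
    Fin.sum_univ_eq_sum_range (fun j => DD m k j)]
  refine Finset.sum_congr rfl fun j _ => ?_
  unfold DD
  congr 1
  apply propext
  omega

theorem EE_col {m r k : ℕ} (h : m ≤ r) :
    ∑ j : Fin r, EE m j k = if k < m then 1 else 0 := by
  rw [Fin.sum_univ_eq_sum_range (fun j => EE m j k)]
  by_cases hk : k < m
  · rw [Finset.sum_eq_single (if k = 0 then m - 1 else k - 1)]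
    · unfold EE
      split_ifs <;> omega
    · intro b _ hb
      unfold EE
      split_ifs at * <;> omega
    · intro hb
      rw [Finset.mem_range] at hb
      split_ifs at * <;> omega
  · rw [if_neg hk]
    refine Finset.sum_eq_zero fun j _ => ?_
    unfold EE
    split_ifs <;> omega

/-- first monomial -/
noncomputable def aa (m r c : ℕ) : Fin 3 × Fin r × Fin c →₀ ℕ :=
  Finsupp.equivFunOnFinite.symm fun p =>
    ![DD m p.2.1 p.2.2, EE m p.2.1 p.2.2, 0] p.1

/-- second monomial -/
noncomputable def bb (m r c : ℕ) : Fin 3 × Fin r × Fin c →₀ ℕ :=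
  Finsupp.equivFunOnFinite.symm fun p =>
    ![EE m p.2.1 p.2.2, DD m p.2.1 p.2.2, 0] p.1

theorem FF_aa_bb {m r c : ℕ} (hr : m ≤ r) (hc : m ≤ c) :
    FF r c (aa m r c) = FF r c (bb m r c) := by
  ext x
  rcases x with ⟨i, j⟩ | ⟨i, k⟩ | ⟨j, k⟩
  · rw [FF_inl, FF_inl]
    fin_cases i <;> simp [aa, bb, DD_row hc, EE_row hc]
  · rw [FF_inm, FF_inm]
    fin_cases i <;> simp [aa, bb, DD_col hr, EE_col hr]
  · rw [FF_inr, FF_inr]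
    simp [aa, bb, Fin.sum_univ_three, add_comm]

theorem DE_disj {m j k : ℕ} (hm : 2 ≤ m) : DD m j k = 0 ∨ EE m j k = 0 := by
  unfold DD EE
  split_ifs <;> omega

theorem aa_bb_disj {m r c : ℕ} (hm : 2 ≤ m) (p : Fin 3 × Fin r × Fin c) :
    aa m r c p = 0 ∨ bb m r c p = 0 := by
  obtain ⟨i, j, k⟩ := p
  have := DE_disj (j := j) (k := k) hm
  fin_cases i
  · simpa [aa, bb] using this
  · simpa [aa, bb] using this.symm
  · simp [aa]

theorem aa_degree {m r c : ℕ} (hr : m ≤ r) (hc : m ≤ c) :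
    (aa m r c).sum (fun _ e => e) = 2 * m := by
  rw [Finsupp.sum_fintype _ _ (by simp), Fintype.sum_prod_type]
  have : ∑ j : Fin r, (if (j : ℕ) < m then 1 else 0) = m := by
    rw [Fin.sum_univ_eq_sum_range (fun j => if j < m then 1 else 0), ← Finset.sum_filter,
      Finset.sum_const, smul_eq_mul, mul_one]
    have : (Finset.range r).filter (fun j => j < m) = Finset.range m := by
      ext j
      simp
      omega
    rw [this, Finset.card_range]
  simp only [Fintype.sum_prod_type, Fin.sum_univ_three]
  simp only [aa, Finsupp.equivFunOnFinite_symm_apply_apply, Matrix.cons_val_zero,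
    Matrix.cons_val_one, Matrix.cons_val, DD_row hc, EE_row hc, this, Finset.sum_const_zero]
  omega

theorem fiber {m r c : ℕ} (hm : 2 ≤ m) (hr : m ≤ r) (hc : m ≤ c)
    (s : Fin 3 × Fin r × Fin c →₀ ℕ) (hs : FF r c s = FF r c (aa m r c)) :
    s = aa m r c ∨ s = bb m r c := by
  have hrow : ∀ j : Fin r, ∑ k, s (0, j, k) = if (j : ℕ) < m then 1 else 0 := by
    intro j
    rw [← FF_inl, hs, FF_inl]
    simp [aa, DD_row hc]
  have hcol : ∀ k : Fin c, ∑ j, s (0, j, k) = if (k : ℕ) < m then 1 else 0 := by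
    intro k
    rw [← FF_inm, hs, FF_inm]
    simp [aa, DD_col hr]
  have hz : ∀ (j : Fin r) (k : Fin c), s (2, j, k) = 0 := by
    intro j k
    have h : ∑ k, s (2, j, k) = 0 := by
      rw [← FF_inl, hs, FF_inl]
      simp [aa]
    exact Finset.sum_eq_zero_iff.1 h k (Finset.mem_univ _)
  have hw : ∀ (j : Fin r) (k : Fin c), s (0, j, k) + s (1, j, k) = DD m j k + EE m j k := by
    intro j k
    have h : ∑ i, s (i, j, k) = ∑ i, aa m r c (i, j, k) := by
      rw [← FF_inr, hs, FF_inr]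
    simpa [Fin.sum_univ_three, hz, aa] using h
  -- row relation
  have hR : ∀ (j : ℕ) (hj : j < m) (l : ℕ) (hl : l < c),
      l = (if j + 1 < m then j + 1 else 0) →
      s (0, ⟨j, by omega⟩, ⟨j, by omega⟩) + s (0, ⟨j, by omega⟩, ⟨l, hl⟩) = 1 := by
    intro j hj l hl hll
    have h := hrow ⟨j, by omega⟩
    rw [if_pos hj] at h
    rw [← h]
    symm
    apply Finset.sum_eq_add
    · intro h
      simp only [Fin.mk.injEq] at h
      split_ifs at hll <;> omega
    · rintro ⟨k, hk⟩ _ ⟨h1, h2⟩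
      have := hw ⟨j, by omega⟩ ⟨k, hk⟩
      simp only [ne_eq, Fin.mk.injEq] at h1 h2
      simp only [DD, EE, h1, ← hll, h2, and_false, if_false] at this
      omega
    · simp
    · simp
  have hC : ∀ (j : ℕ) (hj : j + 1 < m),
      s (0, ⟨j, by omega⟩, ⟨j + 1, by omega⟩) + s (0, ⟨j + 1, by omega⟩, ⟨j + 1, by omega⟩) = 1 := by
    intro j hj
    have h := hcol ⟨j + 1, by omega⟩
    rw [if_pos hj] at h
    refine Eq.trans (Eq.symm ?_) h
    apply Finset.sum_eq_add
    · simp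
    · rintro ⟨k, hk⟩ _ ⟨h1, h2⟩
      have := hw ⟨k, hk⟩ ⟨j + 1, by omega⟩
      simp only [ne_eq, Fin.mk.injEq] at h1 h2
      have hd : DD m k (j + 1) = 0 := by
        unfold DD
        rw [if_neg]
        omega
      have he : EE m k (j + 1) = 0 := by
        unfold EE
        rw [if_neg]
        rintro ⟨_, h4⟩
        split_ifs at h4
        omega
      simp only [hd, he] at this
      omega
    · simp
    · simp
  have hD : ∀ (j : ℕ) (hj : j < m), s (0, ⟨j, by omega⟩, ⟨j, by omega⟩) =
      s (0, ⟨0, by omega⟩, ⟨0, by omega⟩) := by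
    intro j
    induction j with
    | zero => intro _; rfl
    | succ j ih =>
      intro hj
      have h1 := ih (by omega)
      have h2 := hC j hj
      have h3 := hR j (by omega) (j + 1) (by omega) (by rw [if_pos hj])
      omega
  have hx : s (0, ⟨0, by omega⟩, ⟨0, by omega⟩) ≤ 1 := by
    have := hR 0 (by omega) 1 (by omega) (by rw [if_pos (by omega)])
    omega
  set x := s (0, ⟨0, by omega⟩, ⟨0, by omega⟩) with hxdef
  have h0 : ∀ (j : Fin r) (k : Fin c), s (0, j, k) = x * DD m j k + (1 - x) * EE m j k := by
    rintro ⟨j, hj⟩ ⟨k, hk⟩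
    have hww := hw ⟨j, hj⟩ ⟨k, hk⟩
    by_cases h1 : j < m ∧ k = j
    · obtain ⟨h1, rfl⟩ := h1
      have hd : DD m k k = 1 := by simp [DD, h1]
      have he : EE m k k = 0 := by
        rcases DE_disj (j := k) (k := k) hm with h | h
        · omega
        · exact h
      simp only [hd, he, hD k h1]
      omega
    · have hd : DD m j k = 0 := by simp only [DD, h1, if_false]
      by_cases h2 : j < m ∧ k = (if j + 1 < m then j + 1 else 0)
      · have he : EE m j k = 1 := by simp only [EE, h2, and_self, if_true]
        have h3 := hR j h2.1 k hk h2.2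
        rw [hD j h2.1] at h3
        simp only [hd, he]
        omega
      · have he : EE m j k = 0 := by simp only [EE, h2, if_false]
        simp only [hd, he] at hww ⊢
        omega
  have h01 : x = 0 ∨ x = 1 := by omega
  rcases h01 with h | h
  · right
    ext ⟨i, j, k⟩
    have e0 := h0 j k
    have e1 := hw j k
    have e2 := hz j k
    rw [h] at e0
    fin_cases i <;> simp [bb] <;> omega
  · left
    ext ⟨i, j, k⟩
    have e0 := h0 j k
    have e1 := hw j k
    have e2 := hz j k
    rw [h] at e0
    fin_cases i <;> simp [aa] <;> omega

theorem key {m r c : ℕ} (hm : 2 ≤ m) (hr : m ≤ r) (hc : m ≤ c)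
    {q u v : Fin 3 × Fin r × Fin c →₀ ℕ} (huv : u ≠ v) (hF : FF r c u = FF r c v)
    (hq : q + u = aa m r c) : u = aa m r c := by
  have h : FF r c (q + v) = FF r c (aa m r c) := by
    rw [← hq, FF_add, FF_add, hF]
  rcases fiber hm hr hc _ h with h | h
  · exact absurd (add_left_cancel (hq.trans h.symm)) huv
  · have : q = 0 := by
      ext p
      have h1 := DFunLike.congr_fun hq p
      have h2 := DFunLike.congr_fun h p
      simp only [Finsupp.add_apply] at h1 h2
      rcases aa_bb_disj (r := r) (c := c) hm p with h3 | h3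
      · simp; omega
      · simp; omega
    rw [← hq, this, zero_add]

/-- For all `r, c ≥ 2`, every binomial generating set of the toric ideal
`I(3,r,c)` of the no-`3`-way-interaction model on `3 × r × c` tables contains a binomial of
total degree at least `2 · min r c`. -/
theorem markov_complexity_three_by_r_by_c
    (K : Type) [Field K] (r c : ℕ) (hr : 2 ≤ r) (hc : 2 ≤ c)
    (G : Set (MvPolynomial (Fin 3 × Fin r × Fin c) K))
    (hGbin : ∀ g ∈ G, IsBinomial K g)
    (hGspan : Ideal.span G = I3 K 3 r c) :
    ∃ f ∈ G, 2 * min r c ≤ f.totalDegree := by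
  by_contra! hdeg
  set m := min r c with hmdef
  have hm : 2 ≤ m := by omega
  have hmr : m ≤ r := by omega
  have hmc : m ≤ c := by omega
  have hab : aa m r c ≠ bb m r c := by
    intro h
    have h1 := aa_degree hmr hmc
    have : aa m r c = 0 := by
      ext p
      rcases aa_bb_disj (r := r) (c := c) hm p with h3 | h3
      · simpa using h3
      · rw [h]; simpa using h3
    rw [this] at h1
    simp at h1
    omega
  have hlow : ∀ g ∈ G, ∀ u, coeff u g ≠ 0 → u ≠ aa m r c := by
    rintro g hg u hu rfl
    have := le_totalDegree (mem_support_iff.2 hu)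
    rw [aa_degree hmr hmc] at this
    have := hdeg g hg
    omega
  have hgen : ∀ g ∈ G, ∀ f : MvPolynomial (Fin 3 × Fin r × Fin c) K,
      coeff (aa m r c) (f * g) = 0 := by
    intro g hg f
    obtain ⟨u, v, huv, hguv⟩ := hGbin g hg
    have hF : FF r c u = FF r c v := by
      rw [← mem_I3_iff K, ← hguv, ← hGspan]
      exact Ideal.subset_span hg
    have hu : u ≠ aa m r c := hlow g hg u (by simp [hguv, huv.symm])
    have hv : v ≠ aa m r c := hlow g hg v (by simp [hguv, huv])
    induction f using MvPolynomial.induction_on' with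
    | monomial q t =>
      have h1 : q + u ≠ aa m r c := fun h => hu (key hm hmr hmc huv hF h)
      have h2 : q + v ≠ aa m r c := fun h => hv (key hm hmr hmc huv.symm hF.symm h)
      rw [hguv, mul_sub, monomial_mul, monomial_mul, coeff_sub, coeff_monomial, coeff_monomial,
        if_neg h1, if_neg h2, sub_zero]
    | add p1 p2 h1 h2 => rw [add_mul, coeff_add, h1, h2, add_zero]
  have hmem : (monomial (aa m r c) 1 - monomial (bb m r c) 1 : MvPolynomial _ K) ∈
      Ideal.span G := by
    rw [hGspan, mem_I3_iff]
    exact FF_aa_bb hmr hmc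
  have hall : ∀ x ∈ Ideal.span G, coeff (aa m r c) x = 0 := by
    intro x hx
    induction hx using Submodule.closure_induction with
    | zero => simp
    | add x y _ _ h1 h2 => rw [coeff_add, h1, h2, add_zero]
    | smul_mem f g hg => exact hgen g hg f
  have := hall _ hmem
  simp [hab.symm] at this

end No3Way
end

section
/- Fix a field k and an integer n ≥ 2, and let H be the hypergraph on vertex set V = {1, …, n} whose edges are all subsets of V of size at least 2. Then the toric ideal I_H is generated by its elements of total degree at most 3. (By the Sturmfels–Zwiernik parametrization, I_H is the vanishing ideal of the image of the tangential variety Tan((P^1)^n) in higher cumulant coordinates, so this ideal is generated in degrees 2 and 3.) -/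
open MvPolynomial

namespace ToricHG

variable (K : Type) [Field K] (V : Type) [Fintype V] [DecidableEq V]

/-- The edges of a hypergraph with edge set `E`, as a type. -/
abbrev Edge (E : Finset (Finset V)) : Type := {e : Finset V // e ∈ E}

/-- The monomial map `t_e ↦ ∏_{v ∈ e} x_v`. -/
noncomputable def phiH (E : Finset (Finset V)) :
    MvPolynomial (Edge V E) K →ₐ[K] MvPolynomial V K :=
  aeval (fun e : Edge V E => ∏ v ∈ e.1, (X v : MvPolynomial V K))

/-- The toric ideal of a hypergraph. -/
noncomputable def toricIdeal (E : Finset (Finset V)) :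
    Ideal (MvPolynomial (Edge V E) K) :=
  RingHom.ker (phiH K V E).toRingHom

/-- The number of edges of the multiset `M` containing `v`, counted with multiplicity. -/
def degIn (E : Finset (Finset V)) (v : V) (M : Multiset (Edge V E)) : ℕ :=
  Multiset.card (M.filter (fun e => v ∈ e.1))

/-- The bicolored edge multiset `(B, R)` is balanced. -/
def Balanced (E : Finset (Finset V)) (B R : Multiset (Edge V E)) : Prop :=
  ∀ v : V, degIn V E v B = degIn V E v R

/-- The binomial arising from the bicolored edge multiset `(B, R)`. -/
noncomputable def binom (E : Finset (Finset V)) (B R : Multiset (Edge V E)) :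
    MvPolynomial (Edge V E) K :=
  (B.map fun e => (X e : MvPolynomial (Edge V E) K)).prod -
    (R.map fun e => (X e : MvPolynomial (Edge V E) K)).prod

/-- The balanced edge set `(B, R)` is primitive. -/
def Primitive (E : Finset (Finset V)) (B R : Multiset (Edge V E)) : Prop :=
  Balanced V E B R ∧
    ¬ ∃ B' R' : Multiset (Edge V E),
        ¬(B' = 0 ∧ R' = 0) ∧ Balanced V E B' R' ∧ B' < B ∧ R' < R

/-- The balanced edge set `(Fb, Fr)` is reducible with separator `S` and
decomposition `((G1b, G1r), S, (G2b, G2r))`. -/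
def ReducibleWith (E : Finset (Finset V))
    (Fb Fr S G1b G1r G2b G2r : Multiset (Edge V E)) : Prop :=
  Balanced V E Fb Fr ∧ S ≠ 0 ∧ S.toFinset ⊆ (Fb + Fr).toFinset ∧
    Balanced V E G1b G1r ∧ Balanced V E G2b G2r ∧
    ¬(G1b = Fb ∧ G1r = Fr) ∧ ¬(G2b = Fb ∧ G2r = Fr) ∧
    S = G1r ∩ G2b ∧ Fb = G1b + G2b ∧ Fr = G1r + G2r

/-- `S` is a splitting set of the balanced edge set `(Eb, Er)` with
decomposition `((G1b, G1r), S, (G2b, G2r))`, i.e. `(Eb, Er) + S` is reducible with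
separator `S` and this decomposition. -/
def SplittingSetWith (E : Finset (Finset V))
    (Eb Er S G1b G1r G2b G2r : Multiset (Edge V E)) : Prop :=
  ReducibleWith V E (Eb + S) (Er + S) S G1b G1r G2b G2r

/-- `S` is a proper splitting set of the balanced edge set `(Eb, Er)`. -/
def ProperSplittingSet (E : Finset (Finset V))
    (Eb Er S : Multiset (Edge V E)) : Prop :=
  ∃ G1b G1r G2b G2r : Multiset (Edge V E),
    SplittingSetWith V E Eb Er S G1b G1r G2b G2r ∧ S < G1r ∧ S < G2b

/-- A binomial: the difference of two distinct monic monomials. -/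
def IsBinomial (E : Finset (Finset V)) (f : MvPolynomial (Edge V E) K) : Prop :=
  ∃ a b : (Edge V E) →₀ ℕ, a ≠ b ∧ f = monomial a 1 - monomial b 1

/-- `f` is an indispensable binomial of the toric ideal of the hypergraph. -/
def Indispensable (E : Finset (Finset V)) (f : MvPolynomial (Edge V E) K) : Prop :=
  ∀ G : Set (MvPolynomial (Edge V E) K),
    (∀ g ∈ G, IsBinomial K V E g) → Ideal.span G = toricIdeal K V E →
      f ∈ G ∨ -f ∈ G

/-- The Graver basis of the toric ideal of the hypergraph: the binomials arising from
primitive balanced edge sets `(B, R)` with `B ≠ R`. -/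
def GraverSet (E : Finset (Finset V)) : Set (MvPolynomial (Edge V E) K) :=
  {f | ∃ B R : Multiset (Edge V E), Primitive V E B R ∧ B ≠ R ∧ f = binom K V E B R}

/-- The ideal `I` is generated in degree at most `d`. -/
def GenInDegLE {σ : Type} (I : Ideal (MvPolynomial σ K)) (d : ℕ) : Prop :=
  I = Ideal.span {f | f ∈ I ∧ f.totalDegree ≤ d}

end ToricHG
namespace ToricHG

section Comb

set_option linter.unusedSectionVars false
set_option linter.unusedSimpArgs false
set_option linter.unusedVariables false

/-- Degree multiset of a multiset of edges. -/
def dg {W : Type} (M : Multiset (Finset W)) : Multiset W := (M.map Finset.val).sum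

structure Adm {W : Type} (r : Multiset (Finset W) → Multiset (Finset W) → Prop) : Prop where
  refl : ∀ M, r M M
  symm : ∀ M N, r M N → r N M
  trans : ∀ M N P, r M N → r N P → r M P
  add : ∀ M N C, r M N → r (M + C) (N + C)
  basic : ∀ M N, Multiset.card M ≤ 3 → Multiset.card N ≤ 3 → (∀ e ∈ M, 2 ≤ e.card) →
    (∀ e ∈ N, 2 ≤ e.card) → dg M = dg N → r M N

def RR {W : Type} (r : Multiset (Finset W) → Multiset (Finset W) → Prop)
    (M N : Multiset (Finset W)) : Prop := r M N ∧ dg M = dg N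

def NF {W : Type} (M : Multiset (Finset W)) : Prop :=
  (∀ e ∈ M, e.card = 2) ∨ ∃ T M', M = T ::ₘ M' ∧ T.card = 3 ∧ ∀ e ∈ M', e.card = 2

variable {W : Type} [DecidableEq W] {r : Multiset (Finset W) → Multiset (Finset W) → Prop}

@[simp] lemma dg_zero : dg (0 : Multiset (Finset W)) = 0 := by simp [dg]
@[simp] lemma dg_cons (e : Finset W) (M : Multiset (Finset W)) : dg (e ::ₘ M) = e.val + dg M := by
  simp [dg]
@[simp] lemma dg_add (M N : Multiset (Finset W)) : dg (M + N) = dg M + dg N := by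
  simp [dg]
@[simp] lemma dg_single (e : Finset W) : dg ({e} : Multiset (Finset W)) = e.val := by
  simp [dg]

lemma pair_val {a b : W} (h : a ≠ b) : ({a, b} : Finset W).val = {a} + {b} := by
  rw [Finset.insert_val_of_notMem (by simpa using h)]; rfl

lemma tri_val {a b c : W} (h : a ≠ b) (h1 : a ≠ c) (h2 : b ≠ c) :
    ({a, b, c} : Finset W).val = {a} + {b} + {c} := by
  rw [Finset.insert_val_of_notMem (by simp [h, h1]), pair_val h2, add_assoc]; rfl

lemma tri_card {a b c : W} (h : a ≠ b) (h1 : a ≠ c) (h2 : b ≠ c) :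
    ({a, b, c} : Finset W).card = 3 := by
  rw [Finset.card_def, tri_val h h1 h2]; simp

lemma RR.refl (h : Adm r) (M : Multiset (Finset W)) : RR r M M := ⟨h.refl M, rfl⟩
lemma RR.trans (h : Adm r) {M N P : Multiset (Finset W)} (h1 : RR r M N) (h2 : RR r N P) :
    RR r M P := ⟨h.trans _ _ _ h1.1 h2.1, h1.2.trans h2.2⟩
lemma RR.add (h : Adm r) {M N : Multiset (Finset W)} (C) (h1 : RR r M N) :
    RR r (M + C) (N + C) := ⟨h.add _ _ _ h1.1, by simp [h1.2]⟩
lemma RR.cons (h : Adm r) {M N : Multiset (Finset W)} (e) (h1 : RR r M N) :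
    RR r (e ::ₘ M) (e ::ₘ N) := by
  have := h1.add h {e}
  rwa [add_comm, add_comm N, Multiset.singleton_add, Multiset.singleton_add] at this

/-- generic local move -/
lemma mv (h : Adm r) (A B C : Multiset (Finset W)) (hA : Multiset.card A ≤ 3)
    (hB : Multiset.card B ≤ 3) (hA2 : ∀ e ∈ A, 2 ≤ e.card) (hB2 : ∀ e ∈ B, 2 ≤ e.card)
    (hd : dg A = dg B) : RR r (A + C) (B + C) :=
  RR.add h C ⟨h.basic A B hA hB hA2 hB2 hd, hd⟩

lemma mem_dg {M : Multiset (Finset W)} {a : W} : a ∈ dg M ↔ ∃ e ∈ M, a ∈ e := by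
  induction M using Multiset.induction with
  | empty => simp
  | cons e M ih => simp [ih]

lemma count_le (c : W) (M : Multiset (Finset W)) : (dg M).count c ≤ Multiset.card M := by
  induction M using Multiset.induction with
  | empty => simp
  | cons e M ih =>
    have := Multiset.nodup_iff_count_le_one.1 e.nodup c
    simp; omega

lemma count_eq (c : W) (M : Multiset (Finset W)) (h : ∀ e ∈ M, c ∈ e) :
    (dg M).count c = Multiset.card M := by
  induction M using Multiset.induction with
  | empty => simp
  | cons e M ih =>
    have h1 := Multiset.count_eq_one_of_mem e.nodup (h e (by simp))
    have := ih (fun e he => h e (by simp [he]))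
    simp; omega

lemma card_two (M : Multiset (Finset W)) (h : ∀ e ∈ M, e.card = 2) :
    Multiset.card (dg M) = 2 * Multiset.card M := by
  induction M using Multiset.induction with
  | empty => simp
  | cons e M ih =>
    have h1 := h e (by simp)
    have := ih (fun e he => h e (by simp [he]))
    simp; omega

lemma NF.card {M : Multiset (Finset W)} (h : NF M) :
    Multiset.card M = Multiset.card (dg M) / 2 := by
  rcases h with h | ⟨T, M', rfl, hT, h⟩
  · have := card_two M h; omega
  · have := card_two M' h; simp; omega

lemma NF.two_le {M : Multiset (Finset W)} (h : NF M) : ∀ e ∈ M, 2 ≤ e.card := by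
  rcases h with h | ⟨T, M', rfl, hT, h⟩
  · intro e he; rw [h e he]
  · intro e he
    rcases Multiset.mem_cons.1 he with rfl | he
    · omega
    · rw [h e he]

lemma NF.cons {M : Multiset (Finset W)} {e : Finset W} (he : e.card = 2) (h : NF M) :
    NF (e ::ₘ M) := by
  rcases h with h | ⟨T, M', rfl, hT, h⟩
  · left; intro f hf
    rcases Multiset.mem_cons.1 hf with rfl | hf
    exacts [he, h f hf]
  · right; refine ⟨T, e ::ₘ M', Multiset.cons_swap _ _ _, hT, ?_⟩
    intro f hf
    rcases Multiset.mem_cons.1 hf with rfl | hf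
    exacts [he, h f hf]

lemma NF.of_cons {M : Multiset (Finset W)} {e : Finset W} (he : e.card = 2) (h : NF (e ::ₘ M)) :
    NF M := by
  rcases h with h | ⟨T, M', hM, hT, h⟩
  · left; intro f hf; exact h f (by simp [hf])
  · right
    rcases Multiset.cons_eq_cons.1 hM with ⟨rfl, _⟩ | ⟨_, cs, rfl, rfl⟩
    · omega
    · exact ⟨T, cs, rfl, hT, fun f hf => h f (by simp [hf])⟩

lemma two_of_mem {e : Finset W} {a : W} (h : e.card = 2) (ha : a ∈ e) : ∃ b, a ≠ b ∧ e = {a, b} := by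
  obtain ⟨x, y, hxy, rfl⟩ := Finset.card_eq_two.1 h
  simp at ha
  rcases ha with rfl | rfl
  · exact ⟨y, hxy, rfl⟩
  · exact ⟨x, hxy.symm, Finset.pair_comm _ _⟩

lemma three_of_mem {e : Finset W} {a : W} (h : e.card = 3) (ha : a ∈ e) :
    ∃ b c, a ≠ b ∧ a ≠ c ∧ b ≠ c ∧ e = {a, b, c} := by
  have h1 : (e.erase a).card = 2 := by rw [Finset.card_erase_of_mem ha, h]
  obtain ⟨x, y, hxy, hx⟩ := Finset.card_eq_two.1 h1
  have h2 : x ∈ e.erase a := by simp [hx]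
  have h3 : y ∈ e.erase a := by simp [hx]
  refine ⟨x, y, (Finset.ne_of_mem_erase h2).symm, (Finset.ne_of_mem_erase h3).symm, hxy, ?_⟩
  rw [← hx, Finset.insert_erase ha]

lemma cover_contra {M N : Multiset (Finset W)} (hM : NF M) (hN : NF N) (hd : dg M = dg N)
    {a b c : W} (hac : a ≠ c) (hbc : b ≠ c) (hab : ({a, b} : Finset W) ∈ N)
    (h : ∀ e ∈ M, c ∈ e) : False := by
  have h1 := count_eq c M h
  have h2 : Multiset.card M = Multiset.card N := by rw [hM.card, hN.card, hd]
  obtain ⟨N', rfl⟩ := Multiset.exists_cons_of_mem hab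
  have h3 := count_le c N'
  have h4 : Multiset.count c ({a, b} : Finset W).val = 0 := by
    apply Multiset.count_eq_zero_of_notMem
    simp [hac.symm, hbc.symm]
  rw [hd] at h1
  simp only [dg_cons, Multiset.count_add, Multiset.card_cons] at *
  omega

lemma key_even (h : Adm r) {M N : Multiset (Finset W)} (hM : ∀ e ∈ M, e.card = 2) (hN : NF N)
    (hd : dg M = dg N) {a b : W} (hne : a ≠ b) (hab : ({a, b} : Finset W) ∈ N) :
    ∃ M', RR r M ({a, b} ::ₘ M') ∧ NF M' := by
  have ha : a ∈ dg M := by rw [hd]; exact mem_dg.2 ⟨_, hab, by simp⟩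
  have hb : b ∈ dg M := by rw [hd]; exact mem_dg.2 ⟨_, hab, by simp⟩
  obtain ⟨e, he, hae⟩ := mem_dg.1 ha
  obtain ⟨f, hf, hbf⟩ := mem_dg.1 hb
  obtain ⟨c, hac, rfl⟩ := two_of_mem (hM e he) hae
  obtain ⟨d, hbd, rfl⟩ := two_of_mem (hM f hf) hbf
  have hM0 : NF M := Or.inl hM
  obtain ⟨M1, rfl⟩ := Multiset.exists_cons_of_mem he
  by_cases hcb : c = b
  · subst hcb
    exact ⟨M1, RR.refl h _, hM0.of_cons (Finset.card_pair hac)⟩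
  have hf' : ({b, d} : Finset W) ∈ M1 := by
    rcases Multiset.mem_cons.1 hf with h1 | h1
    · exfalso
      have : b ∈ ({a, c} : Finset W) := by rw [← h1]; simp
      simp at this; tauto
    · exact h1
  obtain ⟨M2, rfl⟩ := Multiset.exists_cons_of_mem hf'
  have hM2 : ∀ e ∈ M2, e.card = 2 := fun e he => hM e (by simp [he])
  by_cases hcd : c = d
  · subst hcd
    by_cases hall : ∀ e ∈ M2, c ∈ e
    · exact (cover_contra hM0 hN hd hac hbd hab (by
        intro e he
        simp only [Multiset.mem_cons] at he
        rcases he with rfl | rfl | he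
        · simp
        · simp
        · exact hall e he)).elim
    · push Not at hall
      obtain ⟨e, he2, hce⟩ := hall
      obtain ⟨x, y, hxy, rfl⟩ := Finset.card_eq_two.1 (hM2 e he2)
      obtain ⟨M3, rfl⟩ := Multiset.exists_cons_of_mem he2
      simp only [Finset.mem_insert, Finset.mem_singleton, not_or] at hce
      obtain ⟨hce1, hce2⟩ := hce
      refine ⟨{c, x} ::ₘ {c, y} ::ₘ M3, ?_, ?_⟩
      · have := mv h {{a, c}, {b, c}, {x, y}} {{a, b}, {c, x}, {c, y}} M3 (by simp) (by simp)
          (by simp [Finset.card_pair, *]) (by simp [Finset.card_pair, *])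
          (by
            simp (disch := assumption) only [Multiset.insert_eq_cons, dg_cons, dg_single,
              pair_val, tri_val]
            abel)
        simpa [Multiset.insert_eq_cons] using this
      · exact NF.cons (Finset.card_pair hce1) (NF.cons (Finset.card_pair hce2)
          (Or.inl fun e he => hM2 e (by simp [he])))
  · refine ⟨{c, d} ::ₘ M2, ?_, NF.cons (Finset.card_pair hcd) (Or.inl hM2)⟩
    have := mv h {{a, c}, {b, d}} {{a, b}, {c, d}} M2 (by simp) (by simp)
          (by simp [Finset.card_pair, *]) (by simp [Finset.card_pair, *])
          (by
            simp (disch := assumption) only [Multiset.insert_eq_cons, dg_cons, dg_single,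
              pair_val, tri_val]
            abel)
    simpa [Multiset.insert_eq_cons] using this

lemma NF.tri {T : Finset W} {G : Multiset (Finset W)} (hT : T.card = 3)
    (hG : ∀ e ∈ G, e.card = 2) : NF (T ::ₘ G) := Or.inr ⟨T, G, rfl, hT, hG⟩

lemma key_two (h : Adm r) {a b c : W} {G N : Multiset (Finset W)} (hne : a ≠ b) (hac : a ≠ c)
    (hbc : b ≠ c) (hG : ∀ e ∈ G, e.card = 2) (hN : NF N)
    (hd : dg ({a, b, c} ::ₘ G) = dg N) (hab : ({a, b} : Finset W) ∈ N) :
    ∃ M', RR r ({a, b, c} ::ₘ G) ({a, b} ::ₘ M') ∧ NF M' := by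
  by_cases hall : ∀ e ∈ G, c ∈ e
  · exact (cover_contra (NF.tri (tri_card hne hac hbc) hG) hN hd hac hbc hab (by
        intro e he
        simp only [Multiset.mem_cons] at he
        rcases he with rfl | he
        · simp
        · exact hall e he)).elim
  · push Not at hall
    obtain ⟨e, he2, hce⟩ := hall
    obtain ⟨x, y, hxy, rfl⟩ := Finset.card_eq_two.1 (hG e he2)
    obtain ⟨G, rfl⟩ := Multiset.exists_cons_of_mem he2
    simp only [Finset.mem_insert, Finset.mem_singleton, not_or] at hce
    obtain ⟨hce1, hce2⟩ := hce
    refine ⟨{c, x, y} ::ₘ G, ?_, NF.tri (tri_card hce1 hce2 hxy) fun e he => hG e (by simp [he])⟩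
    have := mv h {{a, b, c}, {x, y}} {{a, b}, {c, x, y}} G (by simp) (by simp)
          (by simp [Finset.card_pair, tri_card, *]) (by simp [Finset.card_pair, tri_card, *])
          (by
            simp (disch := assumption) only [Multiset.insert_eq_cons, dg_cons, dg_single,
              pair_val, tri_val]
            abel)
    simpa [Multiset.insert_eq_cons] using this

lemma key_three (h : Adm r) {a b : W} {T : Finset W} {G N : Multiset (Finset W)} (hne : a ≠ b)
    (hT : T.card = 3) (haT : a ∈ T)
    (hG : ∀ e ∈ G, e.card = 2) (hN : NF N)
    (hd : dg (T ::ₘ G) = dg N) (hab : ({a, b} : Finset W) ∈ N) :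
    ∃ M', RR r (T ::ₘ G) ({a, b} ::ₘ M') ∧ NF M' := by
  obtain ⟨c, d, hac, had, hcd, rfl⟩ := three_of_mem hT haT
  by_cases hbc : b = c
  · subst hbc
    exact key_two h hac had hcd hG hN hd hab
  by_cases hbd : b = d
  · subst hbd
    rw [Finset.pair_comm] at hd ⊢
    exact key_two h hne hac hcd.symm hG hN hd hab
  have hb : b ∈ dg (({a, c, d} : Finset W) ::ₘ G) := by
    rw [hd]; exact mem_dg.2 ⟨_, hab, by simp⟩
  have hb' : b ∈ dg G := by
    simpa [hne.symm, hbc, hbd] using hb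
  obtain ⟨e, he, hbe⟩ := mem_dg.1 hb'
  obtain ⟨f, hbf, rfl⟩ := two_of_mem (hG e he) hbe
  obtain ⟨G, rfl⟩ := Multiset.exists_cons_of_mem he
  have hG' : ∀ e ∈ G, e.card = 2 := fun e he => hG e (by simp [he])
  by_cases hfa : f = a
  · subst hfa
    refine ⟨{f, c, d} ::ₘ G, ?_, NF.tri hT hG'⟩
    rw [Finset.pair_comm f b, Multiset.cons_swap]
    exact RR.refl h _
  -- the case where the edge at `b` ends in the triple
  have aux : ∀ c d : W, a ≠ c → a ≠ d → c ≠ d → b ≠ c → b ≠ d →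
      dg (({a, c, d} : Finset W) ::ₘ {b, c} ::ₘ G) = dg N →
      ∃ M', RR r (({a, c, d} : Finset W) ::ₘ {b, c} ::ₘ G) ({a, b} ::ₘ M') ∧ NF M' := by
    intro c d hac had hcd hbc hbd hd
    have := mv h {{a, c, d}, {b, c}} {{a, b, c}, {c, d}} G (by simp) (by simp)
          (by simp [Finset.card_pair, tri_card, *]) (by simp [Finset.card_pair, tri_card, *])
          (by
            simp (disch := assumption) only [Multiset.insert_eq_cons, dg_cons, dg_single,
              pair_val, tri_val]
            abel)
    simp only [Multiset.insert_eq_cons, Multiset.cons_add, Multiset.singleton_add] at this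
    obtain ⟨M', h1, h2⟩ := key_two h (G := {c, d} ::ₘ G) hne hac hbc (by
      intro e he
      rcases Multiset.mem_cons.1 he with rfl | he
      · exact Finset.card_pair hcd
      · exact hG' e he) hN (this.2.symm.trans hd) hab
    exact ⟨M', this.trans h h1, h2⟩
  by_cases hfc : f = c
  · subst hfc
    exact aux f d hac had hcd hbc hbd hd
  by_cases hfd : f = d
  · subst hfd
    rw [Finset.pair_comm c f] at hd ⊢
    exact aux f c had hac hcd.symm hbd hbc hd
  refine ⟨{c, d, f} ::ₘ G, ?_, NF.tri (tri_card hcd (Ne.symm hfc) (Ne.symm hfd)) hG'⟩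
  have hfc' := Ne.symm hfc
  have hfd' := Ne.symm hfd
  have := mv h {{a, c, d}, {b, f}} {{a, b}, {c, d, f}} G (by simp) (by simp)
          (by simp [Finset.card_pair, tri_card, *]) (by simp [Finset.card_pair, tri_card, *])
          (by
            simp (disch := assumption) only [Multiset.insert_eq_cons, dg_cons, dg_single,
              pair_val, tri_val]
            abel)
  simpa [Multiset.insert_eq_cons] using this

lemma key_odd (h : Adm r) {a b : W} {T : Finset W} {G N : Multiset (Finset W)} (hne : a ≠ b)
    (hT : T.card = 3) (hG : ∀ e ∈ G, e.card = 2) (hN : NF N)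
    (hd : dg (T ::ₘ G) = dg N) (hab : ({a, b} : Finset W) ∈ N) :
    ∃ M', RR r (T ::ₘ G) ({a, b} ::ₘ M') ∧ NF M' := by
  by_cases haT : a ∈ T
  · exact key_three h hne hT haT hG hN hd hab
  have ha : a ∈ dg (T ::ₘ G) := by
    rw [hd]; exact mem_dg.2 ⟨_, hab, by simp⟩
  have ha' : a ∈ dg G := by
    simpa [haT] using ha
  obtain ⟨e, he, hae⟩ := mem_dg.1 ha'
  obtain ⟨f, haf, rfl⟩ := two_of_mem (hG e he) hae
  obtain ⟨G, rfl⟩ := Multiset.exists_cons_of_mem he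
  have hG' : ∀ e ∈ G, e.card = 2 := fun e he => hG e (by simp [he])
  obtain ⟨x, hxT, hxf⟩ := Finset.exists_mem_ne (by omega : 1 < T.card) f
  obtain ⟨c, d, hxc, hxd, hcd, rfl⟩ := three_of_mem hT hxT
  simp only [Finset.mem_insert, Finset.mem_singleton, not_or] at haT
  obtain ⟨hax, hac, had⟩ := haT
  have := mv h {{x, c, d}, {a, f}} {{a, c, d}, {x, f}} G (by simp) (by simp)
          (by simp [Finset.card_pair, tri_card, *]) (by simp [Finset.card_pair, tri_card, *])
          (by
            simp (disch := assumption) only [Multiset.insert_eq_cons, dg_cons, dg_single,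
              pair_val, tri_val]
            abel)
  simp only [Multiset.insert_eq_cons, Multiset.cons_add, Multiset.singleton_add] at this
  obtain ⟨M', h1, h2⟩ := key_three h (G := {x, f} ::ₘ G) hne (tri_card hac had hcd) (by simp) (by
      intro e he
      rcases Multiset.mem_cons.1 he with rfl | he
      · exact Finset.card_pair hxf
      · exact hG' e he) hN (this.2.symm.trans hd) hab
  exact ⟨M', this.trans h h1, h2⟩

lemma key (h : Adm r) {M N : Multiset (Finset W)} (hM : NF M) (hN : NF N)
    (hd : dg M = dg N) {a b : W} (hne : a ≠ b) (hab : ({a, b} : Finset W) ∈ N) :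
    ∃ M', RR r M ({a, b} ::ₘ M') ∧ NF M' := by
  rcases hM with hM | ⟨T, G, rfl, hT, hG⟩
  · exact key_even h hM hN hd hne hab
  · exact key_odd h hne hT hG hN hd hab

lemma nf_conn (h : Adm r) (k : ℕ) : ∀ {M N : Multiset (Finset W)}, Multiset.card N = k →
    NF M → NF N → dg M = dg N → r M N := by
  induction k with
  | zero =>
    intro M N hk hM hN hd
    have h2 : Multiset.card M = Multiset.card N := by rw [hM.card, hN.card, hd]
    exact h.basic M N (by omega) (by omega) hM.two_le hN.two_le hd
  | succ k ih =>
    intro M N hk hM hN hd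
    have h2 : Multiset.card M = Multiset.card N := by rw [hM.card, hN.card, hd]
    by_cases hex : ∃ e ∈ N, e.card = 2
    · obtain ⟨e, he, hc⟩ := hex
      obtain ⟨a, b, hab, rfl⟩ := Finset.card_eq_two.1 hc
      obtain ⟨M', hR, hM'⟩ := key h hM hN hd hab he
      obtain ⟨N', rfl⟩ := Multiset.exists_cons_of_mem he
      have hd' : dg M' = dg N' := by
        have := hR.2.symm.trans hd
        simpa using this
      have h3 := ih (by simpa using hk) hM' (hN.of_cons hc) hd'
      exact h.trans _ _ _ hR.1 (RR.cons h _ ⟨h3, hd'⟩).1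
    · push Not at hex
      have hc : Multiset.card N ≤ 1 := by
        rcases hN with hN | ⟨T, G, rfl, hT, hG⟩
        · obtain ⟨e, he⟩ := Multiset.card_pos_iff_exists_mem.1 (by omega : 0 < Multiset.card N)
          exact absurd (hN e he) (hex e he)
        · have : G = 0 := Multiset.eq_zero_of_forall_notMem fun e he =>
            hex e (by simp [he]) (hG e he)
          simp [this]
      exact h.basic M N (by omega) (by omega) hM.two_le hN.two_le hd

lemma RR.add2 (h : Adm r) {M N M' N' : Multiset (Finset W)} (h1 : RR r M N) (h2 : RR r M' N') :
    RR r (M + M') (N + N') := by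
  refine (h1.add h M').trans h ?_
  rw [add_comm N, add_comm N]
  exact h2.add h N

lemma derange {a b c d e f : W} (h1 : a ≠ b) (h2 : a ≠ c) (h3 : b ≠ c)
    (h4 : d ≠ e) (h5 : d ≠ f) (h6 : e ≠ f) :
    (a ≠ d ∧ b ≠ e ∧ c ≠ f) ∨ (a ≠ d ∧ b ≠ f ∧ c ≠ e) ∨ (a ≠ e ∧ b ≠ d ∧ c ≠ f) ∨
    (a ≠ e ∧ b ≠ f ∧ c ≠ d) ∨ (a ≠ f ∧ b ≠ d ∧ c ≠ e) ∨ (a ≠ f ∧ b ≠ e ∧ c ≠ d) := by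
  grind

lemma two_tri (h : Adm r) {S T : Finset W} (hS : S.card = 3) (hT : T.card = 3) :
    ∃ P : Multiset (Finset W), RR r {S, T} P ∧ ∀ e ∈ P, e.card = 2 := by
  obtain ⟨a, b, c, h1, h2, h3, rfl⟩ := Finset.card_eq_three.1 hS
  obtain ⟨d, e, f, h4, h5, h6, rfl⟩ := Finset.card_eq_three.1 hT
  have aux : ∀ x y z : W, a ≠ x → b ≠ y → c ≠ z →
      ({x} + {y} + {z} : Multiset W) = {d} + {e} + {f} → 
      ∃ P : Multiset (Finset W), RR r {{a, b, c}, {d, e, f}} P ∧ ∀ e ∈ P, e.card = 2 := by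
    intro x y z hx hy hz hxyz
    refine ⟨{{a, x}, {b, y}, {c, z}}, ?_, by simp [Finset.card_pair, *]⟩
    have := mv h {{a, b, c}, {d, e, f}} {{a, x}, {b, y}, {c, z}} 0 (by simp) (by simp)
          (by simp [tri_card, *]) (by simp [Finset.card_pair, *])
          (by
            simp only [Multiset.insert_eq_cons, dg_cons, dg_single, pair_val hx, pair_val hy,
              pair_val hz, tri_val h1 h2 h3, tri_val h4 h5 h6, ← hxyz]
            abel)
    simpa using this
  rcases derange h1 h2 h3 h4 h5 h6 with h | h | h | h | h | h
  · exact aux _ _ _ h.1 h.2.1 h.2.2 (by abel)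
  · exact aux _ _ _ h.1 h.2.1 h.2.2 (by abel)
  · exact aux _ _ _ h.1 h.2.1 h.2.2 (by abel)
  · exact aux _ _ _ h.1 h.2.1 h.2.2 (by abel)
  · exact aux _ _ _ h.1 h.2.1 h.2.2 (by abel)
  · exact aux _ _ _ h.1 h.2.1 h.2.2 (by abel)

lemma NF.add_two {M N : Multiset (Finset W)} (hM : ∀ e ∈ M, e.card = 2) (hN : NF N) :
    NF (M + N) := by
  induction M using Multiset.induction with
  | empty => simpa
  | cons e M ih =>
    rw [Multiset.cons_add]
    exact NF.cons (hM e (by simp)) (ih fun f hf => hM f (by simp [hf]))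

lemma nf_add (h : Adm r) {M N : Multiset (Finset W)} (hM : NF M) (hN : NF N) :
    ∃ P, RR r (M + N) P ∧ NF P := by
  rcases hM with hM | ⟨S, M, rfl, hS, hM⟩
  · exact ⟨_, RR.refl h _, NF.add_two hM hN⟩
  rcases hN with hN | ⟨T, N, rfl, hT, hN⟩
  · exact ⟨_, RR.refl h _, by rw [add_comm]; exact NF.add_two hN (NF.tri hS hM)⟩
  obtain ⟨P, hP, hP2⟩ := two_tri h hS hT
  refine ⟨P + (M + N), ?_, NF.add_two hP2 (NF.add_two hM (Or.inl hN))⟩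
  have := hP.add h (M + N)
  convert this using 1
  simp only [Multiset.insert_eq_cons, ← Multiset.singleton_add]
  abel

lemma nf_edge (h : Adm r) (k : ℕ) : ∀ e : Finset W, e.card = k → 2 ≤ k →
    ∃ P, RR r {e} P ∧ NF P := by
  induction k using Nat.strong_induction_on with
  | _ k ih =>
  intro e he hk
  by_cases h2 : k = 2
  · exact ⟨{e}, RR.refl h _, Or.inl (by simp; omega)⟩
  by_cases h3 : k = 3
  · exact ⟨{e}, RR.refl h _, Or.inr ⟨e, 0, rfl, by omega, by simp⟩⟩
  obtain ⟨s, hs, hsc⟩ := Finset.exists_subset_card_eq (by omega : 2 ≤ e.card)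
  have hc : (e \ s).card = k - 2 := by rw [Finset.card_sdiff_of_subset hs]; omega
  obtain ⟨P, hP, hP2⟩ := ih (k - 2) (by omega) (e \ s) hc (by omega)
  refine ⟨s ::ₘ P, ?_, hP2.cons hsc⟩
  have := mv h {e} {s, e \ s} 0 (by simp) (by simp) (by simp; omega) (by simp; omega) (by
    simp only [Multiset.insert_eq_cons, dg_cons, dg_single, Finset.sdiff_val]
    exact (add_tsub_cancel_of_le (Finset.val_le_iff.2 hs)).symm)
  simp only [add_zero, Multiset.insert_eq_cons] at this
  exact this.trans h (hP.cons h s)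

lemma nf_exists (h : Adm r) (M : Multiset (Finset W)) (hM : ∀ e ∈ M, 2 ≤ e.card) :
    ∃ P, RR r M P ∧ NF P := by
  induction M using Multiset.induction with
  | empty => exact ⟨0, RR.refl h _, Or.inl (by simp)⟩
  | cons e M ih =>
    obtain ⟨P, h1, h2⟩ := ih fun f hf => hM f (by simp [hf])
    obtain ⟨Q, h3, h4⟩ := nf_edge h _ e rfl (hM e (by simp))
    obtain ⟨S, h5, h6⟩ := nf_add h h4 h2
    refine ⟨S, ?_, h6⟩
    rw [← Multiset.singleton_add]
    exact (h3.add2 h h1).trans h h5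

theorem conn (h : Adm r) {M N : Multiset (Finset W)} (hM : ∀ e ∈ M, 2 ≤ e.card)
    (hN : ∀ e ∈ N, 2 ≤ e.card) (hd : dg M = dg N) : r M N := by
  obtain ⟨P, h1, h2⟩ := nf_exists h M hM
  obtain ⟨Q, h3, h4⟩ := nf_exists h N hN
  exact h.trans _ _ _ h1.1 (h.trans _ _ _
    (nf_conn h _ rfl h2 h4 (h1.2.symm.trans (hd.trans h3.2))) (h.symm _ _ h3.1))

end Comb

end ToricHG

namespace ToricHG

section Alg

set_option linter.unusedSectionVars false

variable {K : Type} [Field K] {W : Type} [Fintype W] [DecidableEq W] {E : Finset (Finset W)}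

open Classical in
noncomputable def gX (K : Type) [Field K] (E : Finset (Finset W)) (e : Finset W) :
    MvPolynomial (Edge W E) K :=
  if h : e ∈ E then X ⟨e, h⟩ else 0

noncomputable def lowIdeal (K : Type) [Field K] (E : Finset (Finset W)) :
    Ideal (MvPolynomial (Edge W E) K) :=
  Ideal.span {f | f ∈ toricIdeal K W E ∧ f.totalDegree ≤ 3}

lemma phi_prod (M : Multiset (Finset W)) (hM : ∀ e ∈ M, e ∈ E) :
    phiH K W E (M.map (gX K E)).prod = ((dg M).map (X : W → MvPolynomial W K)).prod := by
  induction M using Multiset.induction with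
  | empty => simp
  | cons e M ih =>
    have he : e ∈ E := hM e (by simp)
    simp only [Multiset.map_cons, Multiset.prod_cons, map_mul, dg_cons, Multiset.map_add,
      Multiset.prod_add]
    rw [ih fun f hf => hM f (by simp [hf])]
    simp [gX, he, phiH]

lemma deg_prod (M : Multiset (Finset W)) :
    (M.map (gX K E)).prod.totalDegree ≤ Multiset.card M := by
  induction M using Multiset.induction with
  | empty => simp
  | cons e M ih =>
    simp only [Multiset.map_cons, Multiset.prod_cons, Multiset.card_cons]
    refine (totalDegree_mul _ _).trans ?_
    have : (gX K E e).totalDegree ≤ 1 := by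
      unfold gX
      split_ifs
      · simp
      · simp
    omega

lemma adm (hE : ∀ e : Finset W, 2 ≤ e.card → e ∈ E) :
    Adm (fun M N : Multiset (Finset W) =>
      (M.map (gX K E)).prod - (N.map (gX K E)).prod ∈ lowIdeal K E) where
  refl M := by simp
  symm M N h := by simpa using (lowIdeal K E).neg_mem h
  trans M N P h1 h2 := by simpa using (lowIdeal K E).add_mem h1 h2
  add M N C h := by
    have := (lowIdeal K E).mul_mem_right (C.map (gX K E)).prod h
    simpa [sub_mul] using this
  basic M N h1 h2 h3 h4 h5 := by
    apply Ideal.subset_span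
    constructor
    · change phiH K W E _ = 0
      rw [map_sub, phi_prod M fun e he => hE e (h3 e he), phi_prod N fun e he => hE e (h4 e he),
        h5, sub_self]
    · exact (totalDegree_sub _ _).trans
        (max_le ((deg_prod M).trans h1) ((deg_prod N).trans h2))

lemma prod_X {A : Type} [DecidableEq A] (s : Multiset A) :
    (s.map (X : A → MvPolynomial A K)).prod = monomial (Multiset.toFinsupp s) 1 := by
  induction s using Multiset.induction with
  | empty => simp
  | cons a s ih =>
    rw [Multiset.map_cons, Multiset.prod_cons, ih, ← Multiset.singleton_add, map_add,
      Multiset.toFinsupp_singleton, X, monomial_mul, one_mul]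

lemma monomial_prod (d : Edge W E →₀ ℕ) :
    (monomial d 1 : MvPolynomial (Edge W E) K) =
      (((Finsupp.toMultiset d).map Subtype.val).map (gX K E)).prod := by
  have h : (gX K E) ∘ (Subtype.val : Edge W E → Finset W) = X := by
    funext e
    simp [gX]
  rw [Multiset.map_map, h, prod_X, Finsupp.toMultiset_toFinsupp]

lemma phi_monomial (d : Edge W E →₀ ℕ) :
    phiH K W E (monomial d 1) =
      monomial (Multiset.toFinsupp (dg ((Finsupp.toMultiset d).map Subtype.val))) 1 := by
  rw [monomial_prod, phi_prod _ (by
    intro e he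
    obtain ⟨x, _, rfl⟩ := Multiset.mem_map.1 he
    exact x.2), prod_X]

lemma low_of_eq (hE : ∀ e : Finset W, e ∈ E ↔ 2 ≤ e.card) (d d' : Edge W E →₀ ℕ)
    (h : phiH K W E (monomial d 1) = phiH K W E (monomial d' 1)) :
    (monomial d 1 - monomial d' 1 : MvPolynomial (Edge W E) K) ∈ lowIdeal K E := by
  rw [phi_monomial, phi_monomial] at h
  have h1 := Multiset.toFinsupp.injective (monomial_left_injective (one_ne_zero) h)
  rw [monomial_prod, monomial_prod]
  have aux : ∀ d : Edge W E →₀ ℕ, ∀ e ∈ (Finsupp.toMultiset d).map Subtype.val,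
      2 ≤ Finset.card e := by
    intro d e he
    obtain ⟨x, _, rfl⟩ := Multiset.mem_map.1 he
    exact (hE _).1 x.2
  exact conn (adm (K := K) fun e he => (hE e).2 he) (aux d) (aux d') h1

open Classical in
noncomputable def secX (K : Type) [Field K] (E : Finset (Finset W)) (w : W →₀ ℕ) :
    MvPolynomial (Edge W E) K :=
  if h : ∃ d : Edge W E →₀ ℕ, phiH K W E (monomial d 1) = monomial w 1 then
    monomial h.choose 1 else 0

lemma sub_mem_low (hE : ∀ e : Finset W, e ∈ E ↔ 2 ≤ e.card) (f : MvPolynomial (Edge W E) K) :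
    f - (basisMonomials W K).constr K (secX K E) (phiH K W E f) ∈ lowIdeal K E := by
  have mono : ∀ d : Edge W E →₀ ℕ, (monomial d 1 : MvPolynomial (Edge W E) K) -
      (basisMonomials W K).constr K (secX K E) (phiH K W E (monomial d 1)) ∈ lowIdeal K E := by
    intro d
    obtain ⟨w, hw⟩ : ∃ w, phiH K W E (monomial d 1) = monomial w 1 := ⟨_, phi_monomial d⟩
    have hex : ∃ d : Edge W E →₀ ℕ, phiH K W E (monomial d 1) = monomial w 1 := ⟨d, hw⟩
    have h1 : (basisMonomials W K).constr K (secX K E) (monomial w 1) = secX K E w := by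
      have h3 := (basisMonomials W K).constr_basis K (secX K E) w
      rwa [coe_basisMonomials] at h3
    rw [hw, h1, secX, dif_pos hex]
    exact low_of_eq hE _ _ (hw.trans hex.choose_spec.symm)
  induction f using MvPolynomial.induction_on' with
  | monomial d a =>
    have h2 : (monomial d a : MvPolynomial (Edge W E) K) = a • monomial d 1 := by
      simp [smul_monomial]
    rw [h2, map_smul, map_smul, ← smul_sub, smul_eq_C_mul]
    exact (lowIdeal K E).mul_mem_left _ (mono d)
  | add p q hp hq =>
    rw [map_add, map_add, add_sub_add_comm]
    exact (lowIdeal K E).add_mem hp hq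

end Alg

end ToricHG

namespace ToricHG

/-- For `n ≥ 2`, the toric ideal of the hypergraph on `{1, …, n}` whose edges
are all subsets of size at least `2` (the vanishing ideal of the image of `Tan((ℙ¹)ⁿ)` in higher
cumulant coordinates) is generated by its elements of total degree at most `3`. -/
theorem tangential_variety_cumulants_gen_in_degree_three
    (K : Type) [Field K] (n : ℕ) (hn : 2 ≤ n)
    (E : Finset (Finset (Fin n)))
    (hEdef : E = Finset.univ.filter (fun e : Finset (Fin n) => 2 ≤ e.card)) :
    GenInDegLE K (toricIdeal K (Fin n) E) 3 := by
  apply le_antisymm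
  · intro f hf
    have hf0 : phiH K (Fin n) E f = 0 := hf
    have := sub_mem_low (E := E) (by simp [hEdef]) f
    rw [hf0, map_zero, sub_zero] at this
    exact this
  · rw [Ideal.span_le]
    exact fun f hf => hf.1

end ToricHG
end
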